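/- arXiv:2110.13743 — 2 statements merged into one kernel-verified Lean document; each statement's English description precedes it below -/
import Mathlib

section
/- For all real numbers R₁, R₂ with 0 < R₁ < R₂ ≤ 1, one has Dom_{R₂} ⊆ Dom_{R₁} and the inclusion is strict. A witness to strictness: for any real t with 1/R₂ − 1 < t < 1/R₁ − 1, the function α_t on compositions defined by α_t((1,1,…,1)) = Σ_{m=0}^{n} t^m·Surj(n,m) on the composition with n parts all equal to 1 (for each n ≥ 0) and α_t = 0 on all other compositions, belongs to Dom_{R₁} but not to Dom_{R₂}. -/
open scoped NNReal ENNReal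

/-- A composition: a finite list of positive integers. -/
abbrev Comp := List ℕ+

/-- Harmonic sum `H_s(N) = Σ_{N ≥ n₁ > … > n_r > 0} 1/(n₁^{s₁} ⋯ n_r^{s_r})`,
with `H_ε(N) = 1`. -/
noncomputable def Hc : Comp → ℕ → ℂ
  | [], _ => 1
  | s :: u, N => ∑ n ∈ Finset.Icc 1 N, ((n : ℂ) ^ (s : ℕ))⁻¹ * Hc u (n - 1)

/-- Polylogarithm `Li_s(z) = Σ_{n₁ > … > n_r > 0} z^{n₁}/(n₁^{s₁} ⋯ n_r^{s_r})`,
with `Li_ε = 1` (the `n = 0` term of the `tsum` vanishes since `s ≥ 1`). -/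
noncomputable def LiC : Comp → ℂ → ℂ
  | [], _ => 1
  | s :: u, z => ∑' n : ℕ, z ^ n * ((n : ℂ) ^ (s : ℕ))⁻¹ * Hc u (n - 1)

/-- Weight of a composition. -/
def wt (s : Comp) : ℕ := (s.map fun p => (p : ℕ)).sum

/-- `Li_P(z) = Σ_s P(s)·Li_s(z)` for a (finitely supported) function `P` on
compositions. -/
noncomputable def LiP (P : Comp → ℂ) (z : ℂ) : ℂ := ∑' s : Comp, P s * LiC s z

/-- `H_P(N) = Σ_s P(s)·H_s(N)` for a (finitely supported) function `P` on
compositions. -/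
noncomputable def HP (P : Comp → ℂ) (N : ℕ) : ℂ := ∑' s : Comp, P s * Hc s N

/-- Weight-`n` homogeneous component of a function on compositions. -/
def homog (α : Comp → ℂ) (n : ℕ) : Comp → ℂ := fun s => if wt s = n then α s else 0

/-- `Dom_R`: the set of `α` with `Σ_n sup_{|z|≤r} |Li_{α,n}(z)| < ∞` for every
`r ∈ (0,R)`. -/
noncomputable def DomR (R : ℝ) : Set (Comp → ℂ) :=
  {α | ∀ r : ℝ, 0 < r → r < R →
    (∑' n : ℕ, ⨆ z ∈ Metric.closedBall (0 : ℂ) r, (‖LiP (homog α n) z‖₊ : ℝ≥0∞)) < ⊤}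

/-- `Surj n m` is the number of surjections from `Fin n` onto `Fin m`;
one has `Surj n m = m! · S₂(n,m)`. -/
noncomputable def Surj (n m : ℕ) : ℕ :=
  Fintype.card {f : Fin n → Fin m // Function.Surjective f}

/-- The function on compositions equal to `Σ_{m=0}^{n} t^m·Surj(n,m)` on the
composition with `n` parts all equal to `1`, and `0` elsewhere. -/
noncomputable def alphaT (t : ℝ) : Comp → ℂ := fun s =>
  if ∀ p ∈ s, p = (1 : ℕ+) then
    ((∑ m ∈ Finset.range (s.length + 1), t ^ m * (Surj s.length m : ℝ) : ℝ) : ℂ)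
  else 0


theorem Surj_eq_zero {n m : ℕ} (h : n < m) : Surj n m = 0 := by
  unfold Surj
  rw [Fintype.card_eq_zero_iff]
  refine ⟨fun f => ?_⟩
  have := Fintype.card_le_of_surjective f.1 f.2
  simp at this
  omega

theorem card_image_eq (n k : ℕ) (S : Finset (Fin k)) :
    (Finset.univ.filter fun f : Fin n → Fin k => Finset.univ.image f = S).card
      = Surj n S.card := by
  classical
  unfold Surj
  rw [← Fintype.card_coe]
  have e : Fin S.card ≃ S := S.equivFin.symm
  refine Fintype.card_congr ?_
  refine
    { toFun := fun f => ⟨fun i => e.symm ⟨f.1 i, ?_⟩, ?_⟩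
      invFun := fun g => ⟨fun i => (e (g.1 i) : Fin k), ?_⟩
      left_inv := ?_
      right_inv := ?_ }
  · have := f.2
    simp only [Finset.mem_filter, Finset.mem_univ, true_and] at this
    exact this.le (Finset.mem_image_of_mem f.1 (Finset.mem_univ i))
  · intro y
    have hf := f.2
    simp only [Finset.mem_filter, Finset.mem_univ, true_and] at hf
    have hy : (e y : Fin k) ∈ Finset.univ.image f.1 := by
      rw [hf]; exact (e y).2
    obtain ⟨i, -, hi⟩ := Finset.mem_image.1 hy
    refine ⟨i, ?_⟩
    rw [Equiv.symm_apply_eq]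
    exact Subtype.ext hi
  · simp only [Finset.mem_filter, Finset.mem_univ, true_and]
    ext j
    simp only [Finset.mem_image, Finset.mem_univ, true_and]
    constructor
    · rintro ⟨i, rfl⟩
      exact (e (g.1 i)).2
    · intro hj
      obtain ⟨i, hi⟩ := g.2 (e.symm ⟨j, hj⟩)
      exact ⟨i, by rw [hi]; simp⟩
  · intro f
    ext i
    simp
  · intro g
    ext i
    simp

theorem pow_eq_sum_surj (k n : ℕ) :
    k ^ n = ∑ m ∈ Finset.range (n + 1), k.choose m * Surj n m := by
  classical
  have h1 : k ^ n = (Finset.univ : Finset (Fin n → Fin k)).card := by simp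
  have h2 : k ^ n = ∑ m ∈ Finset.range (k + 1), k.choose m * Surj n m := by
    rw [h1, Finset.card_eq_sum_card_fiberwise
      (f := fun f : Fin n → Fin k => Finset.univ.image f)
      (t := (Finset.univ : Finset (Fin k)).powerset) (by intro f _; simp)]
    simp_rw [card_image_eq]
    rw [Finset.sum_powerset_apply_card (fun m => Surj n m)]
    simp
  rw [h2]
  have a : ∑ m ∈ Finset.range (k + 1), k.choose m * Surj n m
      = ∑ m ∈ Finset.range (k + n + 1), k.choose m * Surj n m := by
    apply Finset.sum_subset
    · intro x; simp; omega
    · intro x _ hx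
      simp at hx
      rw [Nat.choose_eq_zero_of_lt (by omega)]; simp
  have b : ∑ m ∈ Finset.range (n + 1), k.choose m * Surj n m
      = ∑ m ∈ Finset.range (k + n + 1), k.choose m * Surj n m := by
    apply Finset.sum_subset
    · intro x; simp; omega
    · intro x _ hx
      simp at hx
      rw [Surj_eq_zero (by omega)]; simp
  rw [a, b]

theorem tsum_choose_ennreal (m : ℕ) (y : ℝ) (h0 : 0 ≤ y) (h1 : y < 1) :
    ∑' n : ℕ, ((n + m).choose m : ℝ≥0∞) * ENNReal.ofReal y ^ n
      = ENNReal.ofReal (1 / (1 - y) ^ (m + 1)) := by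
  have hn : ‖y‖ < 1 := by rwa [Real.norm_of_nonneg h0]
  have hs := hasSum_choose_mul_geometric_of_norm_lt_one m hn
  rw [← hs.tsum_eq, ENNReal.ofReal_tsum_of_nonneg (fun n => by positivity) hs.summable]
  refine tsum_congr fun n => ?_
  rw [ENNReal.ofReal_mul (by positivity), ENNReal.ofReal_natCast, ENNReal.ofReal_pow h0]

theorem tsum_choose_shift (m : ℕ) (t : ℝ) (ht : 0 < t) :
    ∑' k : ℕ, (k.choose m : ℝ≥0∞) * ENNReal.ofReal (t / (1 + t)) ^ k
      = ENNReal.ofReal (1 + t) * ENNReal.ofReal t ^ m := by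
  have hx1 : t / (1 + t) < 1 := by rw [div_lt_one (by positivity)]; linarith
  have hx0 : 0 ≤ t / (1 + t) := by positivity
  have hinj : Function.Injective (fun n : ℕ => n + m) := fun a b h => by simpa using h
  rw [← hinj.tsum_eq]
  · simp_rw [pow_add, ← mul_assoc]
    rw [ENNReal.tsum_mul_right, tsum_choose_ennreal m _ hx0 hx1, ← ENNReal.ofReal_pow hx0,
      ← ENNReal.ofReal_pow ht.le, ← ENNReal.ofReal_mul (by positivity),
      ← ENNReal.ofReal_mul (by positivity)]
    congr 1
    have : 1 - t / (1 + t) = 1 / (1 + t) := by field_simp; ring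
    rw [this, one_div_pow, one_div_one_div, div_pow, pow_succ]
    field_simp
  · intro k hk
    simp only [Function.mem_support] at hk
    have : m ≤ k := by
      by_contra hlt
      apply hk
      rw [Nat.choose_eq_zero_of_lt (by omega)]; simp
    exact ⟨k - m, by simp; omega⟩

noncomputable def aT (t : ℝ) (n : ℕ) : ℝ :=
  ∑ m ∈ Finset.range (n + 1), t ^ m * (Surj n m : ℝ)

theorem aT_nonneg {t : ℝ} (ht : 0 < t) (n : ℕ) : 0 ≤ aT t n :=
  Finset.sum_nonneg fun m _ => by positivity

theorem aT_eq (t : ℝ) (ht : 0 < t) (n : ℕ) :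
    ENNReal.ofReal (1 + t) * ENNReal.ofReal (aT t n)
      = ∑' k : ℕ, (k : ℝ≥0∞) ^ n * ENNReal.ofReal (t / (1 + t)) ^ k := by
  have h : ∀ k : ℕ, (k : ℝ≥0∞) ^ n * ENNReal.ofReal (t / (1 + t)) ^ k
      = ∑ m ∈ Finset.range (n + 1),
        (Surj n m : ℝ≥0∞) * ((k.choose m : ℝ≥0∞) * ENNReal.ofReal (t / (1 + t)) ^ k) := by
    intro k
    have := congrArg (Nat.cast : ℕ → ℝ≥0∞) (pow_eq_sum_surj k n)
    push_cast at this
    rw [this, Finset.sum_mul]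
    refine Finset.sum_congr rfl fun m _ => by ring
  simp_rw [h]
  rw [Summable.tsum_finsetSum (fun _ _ => ENNReal.summable)]
  simp_rw [ENNReal.tsum_mul_left, tsum_choose_shift _ t ht]
  unfold aT
  rw [ENNReal.ofReal_sum_of_nonneg (fun m _ => by positivity), Finset.mul_sum]
  refine Finset.sum_congr rfl fun m _ => ?_
  rw [ENNReal.ofReal_mul (by positivity), ENNReal.ofReal_natCast, ENNReal.ofReal_pow ht.le]
  ring

/-- harmonic sums of `1,…,1`. -/
noncomputable def hh : ℕ → ℕ → ℝ≥0
  | 0, _ => 1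
  | _ + 1, 0 => 0
  | n + 1, N + 1 => hh (n + 1) N + ((N : ℝ≥0) + 1)⁻¹ * hh n N

theorem Hc_replicate (n N : ℕ) :
    Hc (List.replicate n 1) N = (((hh n N : ℝ≥0) : ℝ) : ℂ) := by
  induction n generalizing N with
  | zero => simp [Hc, hh]
  | succ n ih =>
    induction N with
    | zero => simp [Hc, hh, List.replicate_succ]
    | succ N ihN =>
      rw [List.replicate_succ] at ihN ⊢
      rw [Hc, Finset.sum_Icc_succ_top (by omega)]
      rw [Hc] at ihN
      rw [ihN, hh]
      simp [ih]

noncomputable def LL (q : ℝ≥0) : ℕ → ℝ≥0∞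
  | 0 => 1
  | n + 1 => ∑' N : ℕ, ((q ^ (N + 1) * (((N : ℝ≥0) + 1)⁻¹ * hh n N) : ℝ≥0) : ℝ≥0∞)

theorem LiC_replicate_succ (n : ℕ) (z : ℂ) :
    LiC (List.replicate (n + 1) 1) z
      = ∑' N : ℕ, z ^ (N + 1) * ((((((N : ℝ≥0) + 1)⁻¹ * hh n N : ℝ≥0) : ℝ)) : ℂ) := by
  rw [List.replicate_succ, LiC, ← Nat.succ_injective.tsum_eq]
  · refine tsum_congr fun N => ?_
    simp [Hc_replicate, mul_assoc]
  · intro N hN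
    cases N with
    | zero => simp at hN
    | succ N => exact ⟨N, rfl⟩

theorem hh_gen (k N : ℕ) :
    ∑' n : ℕ, (k : ℝ≥0∞) ^ n * (hh n N : ℝ≥0∞) = ((N + k).choose k : ℝ≥0∞) := by
  induction N with
  | zero =>
    rw [tsum_eq_single 0]
    · simp [hh]
    · intro n hn
      obtain ⟨n, rfl⟩ := Nat.exists_eq_succ_of_ne_zero hn
      simp [hh]
  | succ N ih =>
    have hN : ((N : ℝ≥0∞) + 1) ≠ 0 := by positivity
    have hN' : ((N : ℝ≥0∞) + 1) ≠ ⊤ := by finiteness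
    have key : ∑' n : ℕ, (k : ℝ≥0∞) ^ n * (hh n (N + 1) : ℝ≥0∞)
        = (1 + k * ((N : ℝ≥0∞) + 1)⁻¹) * ((N + k).choose k : ℝ≥0∞) := by
      rw [tsum_eq_zero_add' ENNReal.summable, add_mul, one_mul]
      have e : ∀ n : ℕ, (k : ℝ≥0∞) ^ (n + 1) * (hh (n + 1) (N + 1) : ℝ≥0∞)
          = (k : ℝ≥0∞) ^ (n + 1) * (hh (n + 1) N : ℝ≥0∞)
            + (k * ((N : ℝ≥0∞) + 1)⁻¹) * ((k : ℝ≥0∞) ^ n * (hh n N : ℝ≥0∞)) := by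
        intro n
        rw [hh]
        push_cast
        rw [ENNReal.coe_inv (by positivity)]
        push_cast
        ring
      simp_rw [e]
      rw [ENNReal.tsum_add, ENNReal.tsum_mul_left, ih, ← add_assoc]
      congr 1
      rw [← ih, tsum_eq_zero_add' (f := fun n => (k : ℝ≥0∞) ^ n * (hh n N : ℝ≥0∞))
        ENNReal.summable]
      simp [hh]
    rw [key]
    have nat : ((N + 1 + k).choose k) * (N + 1) = (N + 1 + k) * (N + k).choose k := by
      have h1 := Nat.add_one_mul_choose_eq (N + k) N
      have h2 : (N + k).choose N = (N + k).choose k := Nat.choose_symm_add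
      have h3 : (N + k + 1).choose (N + 1) = (N + 1 + k).choose k := by
        rw [show N + k + 1 = N + 1 + k by ring]; exact Nat.choose_symm_add
      rw [h2, h3] at h1
      rw [← h1]; ring
    have nat' := congrArg (Nat.cast : ℕ → ℝ≥0∞) nat
    push_cast at nat'
    have h1 : (1 + k * ((N : ℝ≥0∞) + 1)⁻¹) = ((N : ℝ≥0∞) + 1 + k) * ((N : ℝ≥0∞) + 1)⁻¹ := by
      rw [add_mul, ENNReal.mul_inv_cancel hN hN']
    rw [h1, mul_right_comm, ← nat', mul_assoc, ENNReal.mul_inv_cancel hN hN', mul_one]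

theorem LL_gen (k : ℕ) (q : ℝ≥0) (hq : q < 1) :
    ∑' n : ℕ, (k : ℝ≥0∞) ^ n * LL q n = ENNReal.ofReal ((1 / (1 - q)) ^ k) := by
  rw [tsum_eq_zero_add' ENNReal.summable]
  have hq1 : (q : ℝ) < 1 := by exact_mod_cast hq
  have e : ∑' n : ℕ, (k : ℝ≥0∞) ^ (n + 1) * LL q (n + 1)
      = ∑' N : ℕ, (q : ℝ≥0∞) ^ (N + 1) *
          ((k * ((N : ℝ≥0∞) + 1)⁻¹) * ((N + k).choose k : ℝ≥0∞)) := by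
    simp_rw [LL, ← ENNReal.tsum_mul_left]
    rw [ENNReal.tsum_comm]
    refine tsum_congr fun N => ?_
    rw [← hh_gen, ← ENNReal.tsum_mul_left, ← ENNReal.tsum_mul_left]
    refine tsum_congr fun n => ?_
    push_cast
    rw [ENNReal.coe_inv (by positivity)]
    push_cast
    ring
  rw [e]
  cases k with
  | zero => simp [LL]
  | succ j =>
    have hc := tsum_choose_ennreal j q q.2 hq1
    rw [tsum_eq_zero_add' ENNReal.summable] at hc
    rw [one_div_pow, ← hc]
    congr 1
    · simp [LL]
    · refine tsum_congr fun N => ?_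
      have hN : ((N : ℝ≥0∞) + 1) ≠ 0 := by positivity
      have hN' : ((N : ℝ≥0∞) + 1) ≠ ⊤ := by finiteness
      have nat := Nat.choose_succ_right_eq (N + 1 + j) j
      rw [show N + 1 + j - j = N + 1 by omega] at nat
      have nat' := congrArg (Nat.cast : ℕ → ℝ≥0∞) nat
      push_cast at nat'
      rw [ENNReal.ofReal_coe_nnreal, mul_comm]
      congr 1
      rw [show N + (j + 1) = N + 1 + j by ring]
      push_cast
      rw [mul_right_comm, mul_comm ((j : ℝ≥0∞) + 1), nat', mul_assoc,
        ENNReal.mul_inv_cancel hN hN', mul_one]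

theorem LL_ne_top (q : ℝ≥0) (hq : q < 1) (n : ℕ) : LL q n ≠ ⊤ := by
  have h := LL_gen 1 q hq
  have h2 := ENNReal.le_tsum (f := fun n => ((1 : ℕ) : ℝ≥0∞) ^ n * LL q n) n
  rw [h] at h2
  simp only [Nat.cast_one, one_pow, one_mul] at h2
  exact ne_top_of_le_ne_top ENNReal.ofReal_ne_top h2

theorem enorm_LiC_le (q : ℝ≥0) (n : ℕ) (z : ℂ) (hz : ‖z‖ₑ ≤ q) :
    ‖LiC (List.replicate n 1) z‖ₑ ≤ LL q n := by
  cases n with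
  | zero => simp [LiC, LL]
  | succ n =>
    rw [LiC_replicate_succ, LL]
    refine enorm_tsum_le_tsum_enorm.trans (ENNReal.tsum_le_tsum fun N => ?_)
    rw [enorm_mul, enorm_pow, ENNReal.coe_mul, ENNReal.coe_pow]
    gcongr
    apply le_of_eq
    rw [← ofReal_norm, Complex.norm_real, Real.norm_of_nonneg (NNReal.coe_nonneg _),
      ENNReal.ofReal_coe_nnreal]

theorem enorm_LiC_eq (q : ℝ≥0) (hq : q < 1) (n : ℕ) :
    ‖LiC (List.replicate n 1) ((q : ℝ) : ℂ)‖ₑ = LL q n := by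
  have ht := LL_ne_top q hq n
  cases n with
  | zero => simp [LiC, LL]
  | succ n =>
    rw [LiC_replicate_succ]
    rw [LL] at ht ⊢
    have hs := ENNReal.tsum_coe_ne_top_iff_summable.1 ht
    rw [← ENNReal.coe_tsum hs]
    have : ∑' N : ℕ, ((q : ℝ) : ℂ) ^ (N + 1) * ((((((N : ℝ≥0) + 1)⁻¹ * hh n N : ℝ≥0) : ℝ)) : ℂ)
        = (((∑' N : ℕ, (q ^ (N + 1) * (((N : ℝ≥0) + 1)⁻¹ * hh n N)) : ℝ≥0) : ℝ) : ℂ) := by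
      rw [NNReal.coe_tsum, Complex.ofReal_tsum]
      refine tsum_congr fun N => ?_
      push_cast
      ring
    rw [this, ← ofReal_norm, Complex.norm_real, Real.norm_of_nonneg (NNReal.coe_nonneg _),
      ENNReal.ofReal_coe_nnreal]

theorem wt_replicate (n : ℕ) : wt (List.replicate n 1) = n := by
  induction n with
  | zero => simp [wt]
  | succ n ih =>
    simp only [wt] at ih
    simp [wt, List.replicate_succ] at ih ⊢
    omega

theorem LiP_alphaT (t : ℝ) (n : ℕ) (z : ℂ) :
    LiP (homog (alphaT t) n) z = (aT t n : ℂ) * LiC (List.replicate n 1) z := by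
  unfold LiP
  rw [tsum_eq_single (List.replicate n 1)]
  · congr 1
    have : ∀ p ∈ List.replicate n (1 : ℕ+), p = 1 := fun p hp => List.eq_of_mem_replicate hp
    rw [homog, if_pos (wt_replicate n), alphaT, if_pos this, List.length_replicate, aT]
  · intro s hs
    have : homog (alphaT t) n s = 0 := by
      unfold homog alphaT
      split_ifs with h1 h2
      · exfalso
        have h3 : s = List.replicate s.length 1 := List.eq_replicate_iff.2 ⟨rfl, h2⟩
        rw [h3, wt_replicate] at h1
        rw [h1] at h3
        exact hs h3
      · rfl
      · rfl
    rw [this, zero_mul]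

theorem iSup_alphaT (t : ℝ) (ht : 0 < t) (n : ℕ) (q : ℝ≥0) (hq : q < 1) :
    (⨆ z ∈ Metric.closedBall (0 : ℂ) q, (‖LiP (homog (alphaT t) n) z‖₊ : ℝ≥0∞))
      = ENNReal.ofReal (aT t n) * LL q n := by
  have ha : ‖(aT t n : ℂ)‖ₑ = ENNReal.ofReal (aT t n) := by
    rw [← ofReal_norm, Complex.norm_real, Real.norm_of_nonneg (aT_nonneg ht n)]
  have hz : ∀ z, (‖LiP (homog (alphaT t) n) z‖₊ : ℝ≥0∞)
      = ENNReal.ofReal (aT t n) * ‖LiC (List.replicate n 1) z‖ₑ := by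
    intro z
    rw [← enorm_eq_nnnorm, LiP_alphaT, enorm_mul, ha]
  simp_rw [hz]
  apply le_antisymm
  · refine iSup₂_le fun z hz => ?_
    gcongr
    apply enorm_LiC_le
    rw [mem_closedBall_zero_iff] at hz
    rw [enorm_eq_nnnorm]
    exact_mod_cast hz
  · rw [← enorm_LiC_eq q hq n]
    refine le_iSup₂_of_le ((q : ℝ) : ℂ) ?_ le_rfl
    simp

theorem tsum_alphaT (t : ℝ) (ht : 0 < t) (q : ℝ≥0) (hq : q < 1) :
    ENNReal.ofReal (1 + t) *
    (∑' n : ℕ, ⨆ z ∈ Metric.closedBall (0 : ℂ) q, (‖LiP (homog (alphaT t) n) z‖₊ : ℝ≥0∞))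
      = (1 - ENNReal.ofReal (t / (1 + t) * (1 / (1 - q))))⁻¹ := by
  have hq1 : (0 : ℝ) < 1 - q := by
    have : (q : ℝ) < 1 := by exact_mod_cast hq
    linarith
  simp_rw [iSup_alphaT t ht _ q hq]
  rw [← ENNReal.tsum_geometric, ← ENNReal.tsum_mul_left]
  simp_rw [← mul_assoc, aT_eq t ht, ← ENNReal.tsum_mul_right]
  rw [ENNReal.tsum_comm]
  refine tsum_congr fun k => ?_
  rw [ENNReal.ofReal_mul (by positivity), mul_pow, ← ENNReal.ofReal_pow (by positivity) (p := 1 / (1 - (q : ℝ))),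
    ← LL_gen k q hq, ← ENNReal.tsum_mul_left]
  refine tsum_congr fun n => by ring

theorem witness (R₁ R₂ : ℝ) (h1 : 0 < R₁) (h12 : R₁ < R₂)
    (h2 : R₂ ≤ 1) (t : ℝ) (ht2 : 1 / R₂ - 1 < t) (ht1 : t < 1 / R₁ - 1) :
    alphaT t ∈ DomR R₁ ∧ alphaT t ∉ DomR R₂ := by
  have hR2 : 0 < R₂ := h1.trans h12
  have ht : 0 < t := by
    have : 1 ≤ 1 / R₂ := by rw [le_div_iff₀ hR2]; linarith
    linarith
  have hc : ENNReal.ofReal (1 + t) ≠ 0 := by simp; linarith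
  have ht1' : (1 + t) * R₁ < 1 := by rw [← lt_div_iff₀ h1]; linarith
  have ht2' : 1 < (1 + t) * R₂ := by rw [← div_lt_iff₀ hR2]; linarith
  constructor
  · intro r hr0 hr
    lift r to ℝ≥0 using hr0.le
    have hr1 : (r : ℝ) < 1 := by linarith
    have h := tsum_alphaT t ht r (by exact_mod_cast hr1)
    rw [lt_top_iff_ne_top]
    intro htop
    rw [htop, ENNReal.mul_top hc, eq_comm, ENNReal.inv_eq_top, tsub_eq_zero_iff_le,
      ENNReal.one_le_ofReal, div_mul_div_comm, le_div_iff₀ (by nlinarith)] at h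
    nlinarith
  · intro hmem
    have hlt : 1 / (1 + t) < R₂ := by rw [div_lt_iff₀ (by positivity)]; linarith
    have hlt1 : 1 / (1 + t) < 1 := by linarith
    have hpos : 0 < 1 / (1 + t) := by positivity
    have h := hmem (1 / (1 + t)) hpos hlt
    have h' := tsum_alphaT t ht ⟨1 / (1 + t), hpos.le⟩ hlt1
    have e : t / (1 + t) * (1 / (1 - 1 / (1 + t))) = 1 := by
      have : 1 - 1 / (1 + t) = t / (1 + t) := by field_simp; ring
      rw [this]
      field_simp
    change _ = (1 - ENNReal.ofReal (t / (1 + t) * (1 / (1 - 1 / (1 + t)))))⁻¹ at h'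
    rw [e] at h'
    simp only [ENNReal.ofReal_one, tsub_self, ENNReal.inv_zero] at h'
    exact (ENNReal.mul_lt_top ENNReal.ofReal_lt_top h).ne h'

/-- For `0 < R₁ < R₂ ≤ 1` one has `Dom_{R₂} ⊊ Dom_{R₁}`; a witness to strictness
is `alphaT t` for any `t` with `1/R₂ − 1 < t < 1/R₁ − 1`. -/
theorem domR_strict_antitone (R₁ R₂ : ℝ) (h1 : 0 < R₁) (h12 : R₁ < R₂)
    (h2 : R₂ ≤ 1) :
    DomR R₂ ⊆ DomR R₁ ∧ DomR R₂ ⊂ DomR R₁ ∧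
    ∀ t : ℝ, 1 / R₂ - 1 < t → t < 1 / R₁ - 1 →
      alphaT t ∈ DomR R₁ ∧ alphaT t ∉ DomR R₂ := by
  have hsub : DomR R₂ ⊆ DomR R₁ := fun α hα r h0 hr => hα r h0 (hr.trans h12)
  refine ⟨hsub, ?_, witness R₁ R₂ h1 h12 h2⟩
  have hlt : 1 / R₂ - 1 < 1 / R₁ - 1 := by
    have := one_div_lt_one_div_of_lt h1 h12
    linarith
  obtain ⟨t, hta, htb⟩ := exists_between hlt
  have hw := witness R₁ R₂ h1 h12 h2 t hta htb
  exact ⟨hsub, fun h => hw.2 (h hw.1)⟩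
end

section
/- Let 0 < R₁, R₂ ≤ 1, α ∈ Dom_{R₁}, β ∈ Dom_{R₂}, and let H_α(N), H_β(N) be the Taylor coefficients at 0 of Li_α(z)/(1−z) and Li_β(z)/(1−z) respectively. Then for every N ∈ ℕ, the series Σ_{n≥0} H_{(α⧛β)_n}(N) converges absolutely and its sum equals H_α(N)·H_β(N), where (α⧛β)_n = Σ_{p+q=n} α_p ⧛ β_q is the weight-n homogeneous component of the stuffle product α ⧛ β. -/
open scoped NNReal ENNReal

/-- Stuffle coefficient on compositions: `⟨u ⧛ v, w⟩`, defined by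
`u ⧛ ε = ε ⧛ u = u` and
`(s::u) ⧛ (t::v) = s::(u ⧛ (t::v)) + t::((s::u) ⧛ v) + (s+t)::(u ⧛ v)`. -/
def stuf : Comp → Comp → Comp → ℤ
  | [], v, w => if w = v then 1 else 0
  | u, [], w => if w = u then 1 else 0
  | _ :: _, _ :: _, [] => 0
  | s :: u, t :: v, c :: w =>
      (if c = s then stuf u (t :: v) w else 0) +
      (if c = t then stuf (s :: u) v w else 0) +
      (if c = s + t then stuf u v w else 0)
termination_by u v _ => u.length + v.length

/-- Bilinear extension of the stuffle to `ℂ`-valued functions on compositions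
(a finite sum for each `w`, realized as a `tsum`). -/
noncomputable def stufA (α β : Comp → ℂ) : Comp → ℂ :=
  fun w => ∑' p : Comp × Comp, α p.1 * β p.2 * (stuf p.1 p.2 w : ℂ)


lemma wt_nil : wt [] = 0 := rfl
lemma wt_cons (s : ℕ+) (u : Comp) : wt (s :: u) = s + wt u := by simp [wt]

lemma wt_le_finite (n : ℕ) : {s : Comp | wt s ≤ n}.Finite := by
  induction n with
  | zero =>
    refine (Set.finite_singleton ([] : Comp)).subset ?_
    rintro (_ | ⟨s, u⟩) h
    · simp
    · have := s.pos
      simp only [Set.mem_ofPred_eq, wt_cons] at h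
      omega
  | succ n ih =>
    have hf : {p : ℕ+ | (p : ℕ) ≤ n + 1}.Finite :=
      (Set.finite_Iic (n + 1)).preimage PNat.coe_injective.injOn
    refine ((Set.finite_singleton ([] : Comp)).union (Set.Finite.image2 List.cons hf ih)).subset ?_
    rintro (_ | ⟨s, u⟩) h
    · simp
    · right
      have := s.pos
      simp only [Set.mem_ofPred_eq, wt_cons] at h
      exact ⟨s, by simp only [Set.mem_ofPred_eq]; omega, u, by simp only [Set.mem_ofPred_eq]; omega, rfl⟩

lemma wt_eq_finite (n : ℕ) : {s : Comp | wt s = n}.Finite :=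
  (wt_le_finite n).subset fun _ h => le_of_eq h

noncomputable def WW (n : ℕ) : Finset Comp := (wt_eq_finite n).toFinset

lemma mem_WW {n : ℕ} {s : Comp} : s ∈ WW n ↔ wt s = n := by simp [WW]

lemma tsum_homog (α : Comp → ℂ) (n : ℕ) (f : Comp → ℂ) :
    ∑' s, homog α n s * f s = ∑ s ∈ WW n, α s * f s := by
  rw [tsum_eq_sum (s := WW n)]
  · refine Finset.sum_congr rfl fun s hs => ?_
    rw [homog, if_pos (mem_WW.1 hs)]
  · intro s hs
    rw [homog, if_neg (fun h => hs (mem_WW.2 h)), zero_mul]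

lemma stuf_nil_left (v w : Comp) : stuf [] v w = if w = v then 1 else 0 := by
  rw [stuf]
lemma stuf_nil_right (u w : Comp) : stuf u [] w = if w = u then 1 else 0 := by
  cases u <;> rw [stuf]; simp
lemma stuf_cons_nil (s t : ℕ+) (u v : Comp) : stuf (s :: u) (t :: v) [] = 0 := by
  rw [stuf]
lemma stuf_cons_cons (s t c : ℕ+) (u v w : Comp) : stuf (s :: u) (t :: v) (c :: w) =
      (if c = s then stuf u (t :: v) w else 0) +
      (if c = t then stuf (s :: u) v w else 0) +
      (if c = s + t then stuf u v w else 0) := by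
  rw [stuf]

lemma stuf_wt : ∀ (u v w : Comp), stuf u v w ≠ 0 → wt w = wt u + wt v
  | [], v, w, h => by
    rw [stuf_nil_left] at h
    have : w = v := by by_contra h'; simp [h'] at h
    simp [this, wt_nil]
  | s :: u, [], w, h => by
    rw [stuf_nil_right] at h
    have : w = s :: u := by by_contra h'; simp [h'] at h
    simp [this, wt_nil]
  | s :: u, t :: v, [], h => by simp [stuf_cons_nil] at h
  | s :: u, t :: v, c :: w, h => by
    rw [stuf_cons_cons] at h
    have h1 := stuf_wt u (t :: v) w
    have h2 := stuf_wt (s :: u) v w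
    have h3 := stuf_wt u v w
    simp only [wt_cons] at *
    by_contra hne
    apply h
    have e1 : (if c = s then stuf u (t :: v) w else 0) = 0 := by
      split_ifs with hc
      · subst hc; by_contra h'; have := h1 h'; omega
      · rfl
    have e2 : (if c = t then stuf (s :: u) v w else 0) = 0 := by
      split_ifs with hc
      · subst hc; by_contra h'; have := h2 h'; omega
      · rfl
    have e3 : (if c = s + t then stuf u v w else 0) = 0 := by
      split_ifs with hc
      · subst hc; by_contra h'; have := h3 h'; rw [PNat.add_coe] at hne; omega
      · rfl
    rw [e1, e2, e3]; rfl
termination_by u v => u.length + v.length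

lemma Hc_cons_zero (s : ℕ+) (u : Comp) : Hc (s :: u) 0 = 0 := by simp [Hc]
lemma Hc_cons_succ (s : ℕ+) (u : Comp) (N : ℕ) :
    Hc (s :: u) (N + 1) = Hc (s :: u) N + (((N + 1 : ℕ) : ℂ) ^ (s : ℕ))⁻¹ * Hc u N := by
  rw [Hc, Hc, Finset.sum_Icc_succ_top (by omega)]; simp

lemma Hc_mul (s t : ℕ+) (u v : Comp) (N : ℕ) :
    Hc (s :: u) N * Hc (t :: v) N =
      ∑ n ∈ Finset.Icc 1 N, ((n : ℂ) ^ (s : ℕ))⁻¹ * (Hc u (n - 1) * Hc (t :: v) (n - 1)) +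
      ∑ n ∈ Finset.Icc 1 N, ((n : ℂ) ^ (t : ℕ))⁻¹ * (Hc (s :: u) (n - 1) * Hc v (n - 1)) +
      ∑ n ∈ Finset.Icc 1 N, ((n : ℂ) ^ ((s + t : ℕ+) : ℕ))⁻¹ * (Hc u (n - 1) * Hc v (n - 1)) := by
  induction N with
  | zero => simp [Hc_cons_zero]
  | succ N ih =>
    simp only [Finset.sum_Icc_succ_top (show 1 ≤ N + 1 by omega), Nat.add_sub_cancel]
    rw [Hc_cons_succ, Hc_cons_succ, PNat.add_coe, pow_add, mul_inv]
    rw [PNat.add_coe] at ih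
    linear_combination ih

lemma hasSum_cons (s : ℕ+) (g : Comp → ℂ) (N : ℕ) (G : ℕ → ℂ)
    (h : ∀ n, HasSum (fun w => g w * Hc w n) (G n)) :
    HasSum (fun w : Comp => match w with
      | [] => 0
      | c :: w' => (if c = s then g w' else 0) * Hc (c :: w') N)
      (∑ n ∈ Finset.Icc 1 N, ((n : ℂ) ^ (s : ℕ))⁻¹ * G (n - 1)) := by
  have hinj : Function.Injective (fun w : Comp => s :: w) := fun a b h => by simpa using h
  rw [← hinj.hasSum_iff]
  · have := hasSum_sum (s := Finset.Icc 1 N) (fun n _ => (h (n - 1)).mul_left (((n : ℂ) ^ (s : ℕ))⁻¹))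
    convert! this using 1
    funext w
    simp only [Function.comp, if_true]
    rw [Hc, Finset.mul_sum]
    refine Finset.sum_congr rfl fun n _ => by ring
  · rintro (_ | ⟨c, w⟩) hw
    · rfl
    · have : c ≠ s := fun h => hw ⟨w, by simp [h]⟩
      simp [this]

lemma stuf_Hc : ∀ (u v : Comp) (N : ℕ),
    HasSum (fun w => (stuf u v w : ℂ) * Hc w N) (Hc u N * Hc v N)
  | [], v, N => by
    simp only [stuf_nil_left]
    convert hasSum_single v ?_ using 1
    · simp [Hc]
    · intro w hw; simp [hw]
  | s :: u, [], N => by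
    simp only [stuf_nil_right]
    convert hasSum_single (s :: u) ?_ using 1
    · simp [Hc]
    · intro w hw; simp [hw]
  | s :: u, t :: v, N => by
    have h1 := hasSum_cons s _ N _ (fun n => stuf_Hc u (t :: v) n)
    have h2 := hasSum_cons t _ N _ (fun n => stuf_Hc (s :: u) v n)
    have h3 := hasSum_cons (s + t) _ N _ (fun n => stuf_Hc u v n)
    rw [Hc_mul]
    refine ((h1.add h2).add h3).congr_fun ?_
    rintro (_ | ⟨c, w⟩)
    · simp [stuf_cons_nil]
    · simp only [stuf_cons_cons]; push_cast; ring
termination_by u v => u.length + v.length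

lemma stuf_Hc_fin (u v : Comp) (N : ℕ) :
    ∑ w ∈ WW (wt u + wt v), (stuf u v w : ℂ) * Hc w N = Hc u N * Hc v N := by
  rw [← (stuf_Hc u v N).tsum_eq, tsum_eq_sum]
  intro w hw
  have : stuf u v w = 0 := by
    by_contra h
    exact hw (mem_WW.2 (stuf_wt u v w h))
  simp [this]

lemma stufA_eq (α β : Comp → ℂ) (n : ℕ) (w : Comp) (hw : w ∈ WW n) :
    stufA α β w = ∑ pq ∈ Finset.HasAntidiagonal.antidiagonal n, ∑ x ∈ WW pq.1 ×ˢ WW pq.2,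
      α x.1 * β x.2 * (stuf x.1 x.2 w : ℂ) := by
  classical
  rw [← Finset.sum_biUnion, stufA, tsum_eq_sum]
  · rintro ⟨u, v⟩ hx
    have : stuf u v w = 0 := by
      by_contra h
      apply hx
      have := stuf_wt u v w h
      rw [mem_WW.1 hw] at this
      simp only [Finset.mem_biUnion, Finset.HasAntidiagonal.mem_antidiagonal, Finset.mem_product, mem_WW]
      exact ⟨(wt u, wt v), this.symm, rfl, rfl⟩
    simp [this]
  · rintro ⟨a, b⟩ _ ⟨c, d⟩ _ hne
    rw [Function.onFun, Finset.disjoint_left]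
    rintro ⟨u, v⟩ h1 h2
    simp only [Finset.mem_product, mem_WW] at h1 h2
    apply hne
    rw [← h1.1, ← h1.2, ← h2.1, ← h2.2]

lemma HP_stufA (α β : Comp → ℂ) (n N : ℕ) :
    HP (homog (stufA α β) n) N =
      ∑ pq ∈ Finset.HasAntidiagonal.antidiagonal n, HP (homog α pq.1) N * HP (homog β pq.2) N := by
  simp only [HP, tsum_homog]
  rw [Finset.sum_congr rfl (fun w hw => by rw [stufA_eq α β n w hw])]
  rw [Finset.sum_congr rfl (fun w _ => by rw [Finset.sum_mul])]
  rw [Finset.sum_comm]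
  refine Finset.sum_congr rfl fun pq hpq => ?_
  rw [Finset.sum_congr rfl (fun w _ => by rw [Finset.sum_mul]), Finset.sum_comm,
    Finset.sum_mul_sum, Finset.sum_product]
  refine Finset.sum_congr rfl fun u hu => Finset.sum_congr rfl fun v hv => ?_
  rw [mem_WW] at hu hv
  have := stuf_Hc_fin u v N
  rw [hu, hv, Finset.HasAntidiagonal.mem_antidiagonal.1 hpq] at this
  have e : α u * Hc u N * (β v * Hc v N) = α u * β v * (Hc u N * Hc v N) := by ring
  rw [e, ← this, Finset.mul_sum]
  exact Finset.sum_congr rfl fun w _ => by ring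

lemma ps_ball (a : ℕ → ℂ) (f : ℂ → ℂ)
    (h : ∀ z : ℂ, ‖z‖ < 1 → HasSum (fun k => a k * z ^ k) (f z)) :
    HasFPowerSeriesOnBall f (FormalMultilinearSeries.ofScalars ℂ a) 0 1 where
  r_le := by
    refine ENNReal.le_of_forall_nnreal_lt fun ρ hρ => ?_
    apply FormalMultilinearSeries.le_radius_of_summable_norm
    have h1 := (h ((ρ : ℝ) : ℂ) (by simpa using hρ)).summable.norm
    simpa [FormalMultilinearSeries.ofScalars_norm] using h1
  r_pos := by simp
  hasSum := by
    intro y hy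
    have hy' : ‖y‖ < 1 := by
      simpa [← ofReal_norm, ENNReal.ofReal_lt_one] using hy
    have := h y hy'
    simpa [FormalMultilinearSeries.ofScalars_apply_eq, mul_comm] using this

lemma ps_at (a : ℕ → ℂ) (f : ℂ → ℂ) (r : ℝ) (hr : 0 < r)
    (h : ∀ z : ℂ, ‖z‖ < r → HasSum (fun k => a k * z ^ k) (f z)) :
    HasFPowerSeriesAt f (FormalMultilinearSeries.ofScalars ℂ a) 0 := by
  rw [hasFPowerSeriesAt_iff]
  filter_upwards [Metric.ball_mem_nhds (0 : ℂ) hr] with z hz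
  have := h z (by simpa using hz)
  simpa [FormalMultilinearSeries.coeff_ofScalars, mul_comm] using this

lemma ps_unique (a b : ℕ → ℂ) (f : ℂ → ℂ) (r : ℝ) (hr : 0 < r)
    (ha : ∀ z : ℂ, ‖z‖ < r → HasSum (fun k => a k * z ^ k) (f z))
    (hb : ∀ z : ℂ, ‖z‖ < r → HasSum (fun k => b k * z ^ k) (f z)) (k : ℕ) : a k = b k := by
  have := (ps_at a f r hr ha).eq_formalMultilinearSeries (ps_at b f r hr hb)
  have h2 := congrArg (fun p => FormalMultilinearSeries.coeff p k) this
  simpa [FormalMultilinearSeries.coeff_ofScalars] using h2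

lemma ps_cauchy (a : ℕ → ℂ) (f : ℂ → ℂ)
    (h : ∀ z : ℂ, ‖z‖ < 1 → HasSum (fun k => a k * z ^ k) (f z))
    (r M : ℝ) (hr0 : 0 < r) (hr1 : r < 1) (hM : ∀ z : ℂ, ‖z‖ ≤ r → ‖f z‖ ≤ M) (k : ℕ) :
    ‖a k‖ ≤ M / r ^ k := by
  have hb := ps_ball a f h
  have hd : DiffContOnCl ℂ f (Metric.ball 0 r) := by
    refine (hb.differentiableOn.mono ?_).diffContOnCl
    intro z hz
    have hz' := Metric.closure_ball_subset_closedBall hz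
    simp only [Metric.mem_closedBall, dist_zero_right] at hz'
    have : ‖z‖ < 1 := lt_of_le_of_lt hz' hr1
    simpa [← ofReal_norm, ENNReal.ofReal_lt_one] using this
  have h1 := Complex.norm_iteratedDeriv_le_of_forall_mem_sphere_norm_le k hr0 hd
    (fun z hz => hM z (by simpa using le_of_eq hz))
  have h2 := hb.factorial_smul 1 k
  rw [iteratedFDeriv_apply_eq_iteratedDeriv_mul_prod, Finset.prod_const_one, one_smul] at h2
  rw [← h2] at h1
  simp at h1
  rw [mul_div_assoc] at h1
  exact le_of_mul_le_mul_left h1 (by positivity)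

/-- Taylor coefficients of `Li_s`. -/
noncomputable def cf : Comp → ℕ → ℂ
  | [], k => if k = 0 then 1 else 0
  | s :: u, k => ((k : ℂ) ^ (s : ℕ))⁻¹ * Hc u (k - 1)

lemma Hc_bound (u : Comp) (N : ℕ) : ‖Hc u N‖ ≤ (N : ℝ) ^ u.length := by
  induction u generalizing N with
  | nil => simp [Hc]
  | cons s u ih =>
    rw [Hc]
    refine (norm_sum_le_of_le (f := fun n : ℕ => ((n : ℂ) ^ (s : ℕ))⁻¹ * Hc u (n - 1))
      (n := fun _ => (N : ℝ) ^ u.length) _ ?_).trans ?_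
    · intro n hn
      obtain ⟨h1, h2⟩ := Finset.mem_Icc.1 hn
      rw [norm_mul, norm_inv, norm_pow, Complex.norm_natCast]
      have e1 : ((n : ℝ) ^ (s : ℕ))⁻¹ ≤ 1 := inv_le_one_of_one_le₀ (one_le_pow₀ (by exact_mod_cast h1))
      have e2 : ‖Hc u (n - 1)‖ ≤ (N : ℝ) ^ u.length := by
        refine (ih _).trans ?_
        gcongr
        omega
      calc _ ≤ 1 * (N : ℝ) ^ u.length := by gcongr
        _ = _ := one_mul _
    · simp [pow_succ, mul_comm]

lemma cf_hasSum (s : Comp) (z : ℂ) (hz : ‖z‖ < 1) :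
    HasSum (fun k => cf s k * z ^ k) (LiC s z) := by
  cases s with
  | nil =>
    have := hasSum_single (f := fun k => cf [] k * z ^ k) 0 (fun k hk => by simp [cf, hk])
    simpa [LiC, cf] using this
  | cons s u =>
    have hs : Summable (fun k => cf (s :: u) k * z ^ k) := by
      have h0 := summable_pow_mul_geometric_of_norm_lt_one (R := ℝ) u.length (r := ‖z‖) (by simpa using hz)
      refine Summable.of_norm_bounded h0 fun k => ?_
      rw [norm_mul, norm_pow, cf]
      gcongr
      rw [norm_mul, norm_inv, norm_pow, Complex.norm_natCast]
      rcases Nat.eq_zero_or_pos k with rfl | hk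
      · simp [s.pos.ne']
      have e1 : ((k : ℝ) ^ (s : ℕ))⁻¹ ≤ 1 := inv_le_one_of_one_le₀ (one_le_pow₀ (by exact_mod_cast hk))
      have e2 : ‖Hc u (k - 1)‖ ≤ (k : ℝ) ^ u.length := by
        refine (Hc_bound _ _).trans ?_
        gcongr
        omega
      calc _ ≤ 1 * (k : ℝ) ^ u.length := by gcongr
        _ = _ := one_mul _
    convert! hs.hasSum using 1
    rw [LiC]
    exact tsum_congr fun k => by rw [cf]; ring

lemma cf_sum (s : Comp) (N : ℕ) : ∑ k ∈ Finset.range (N + 1), cf s k = Hc s N := by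
  cases s with
  | nil => simp [cf, Hc]
  | cons s u =>
    induction N with
    | zero => simp [cf, Hc]
    | succ N ih => rw [Finset.sum_range_succ, ih, Hc_cons_succ, cf]; simp

/-- Taylor coefficients of `Li_{α,n}`. -/
noncomputable def AA (α : Comp → ℂ) (n k : ℕ) : ℂ := ∑ s ∈ WW n, α s * cf s k

lemma AA_hasSum (α : Comp → ℂ) (n : ℕ) (z : ℂ) (hz : ‖z‖ < 1) :
    HasSum (fun k => AA α n k * z ^ k) (LiP (homog α n) z) := by
  rw [LiP, tsum_homog]
  have := hasSum_sum (s := WW n) (fun s _ => (cf_hasSum s z hz).mul_left (α s))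
  convert! this using 1
  funext k
  rw [AA, Finset.sum_mul]
  exact Finset.sum_congr rfl fun s _ => by ring

lemma AA_sum (α : Comp → ℂ) (n N : ℕ) :
    ∑ k ∈ Finset.range (N + 1), AA α n k = HP (homog α n) N := by
  rw [HP, tsum_homog]
  simp only [AA]
  rw [Finset.sum_comm]
  refine Finset.sum_congr rfl fun s _ => ?_
  rw [← Finset.mul_sum, cf_sum]

lemma dom_bound (R : ℝ) (α : Comp → ℂ) (hα : α ∈ DomR R) (r : ℝ) (h0 : 0 < r) (h1 : r < R)
    (hR : R ≤ 1) : ∃ M : ℕ → ℝ, Summable M ∧ (∀ n, 0 ≤ M n) ∧ ∀ n k, ‖AA α n k‖ ≤ M n / r ^ k := by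
  have h := (hα r h0 h1).ne
  refine ⟨_, ENNReal.summable_toReal h, fun n => ENNReal.toReal_nonneg, fun n k => ?_⟩
  refine ps_cauchy (AA α n) _ (fun z hz => AA_hasSum α n z hz) r _ h0 (by linarith) ?_ k
  intro z hz
  have hfin := ENNReal.ne_top_of_tsum_ne_top h n
  have hle : (‖LiP (homog α n) z‖₊ : ℝ≥0∞) ≤
      ⨆ z ∈ Metric.closedBall (0 : ℂ) r, (‖LiP (homog α n) z‖₊ : ℝ≥0∞) :=
    le_iSup₂ (f := fun z (_ : z ∈ Metric.closedBall (0 : ℂ) r) =>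
      (‖LiP (homog α n) z‖₊ : ℝ≥0∞)) z (by simpa using hz)
  simpa using ENNReal.toReal_mono hfin hle

lemma dom_main (R : ℝ) (hR0 : 0 < R) (hR1 : R ≤ 1) (α : Comp → ℂ) (hα : α ∈ DomR R) (Hα : ℕ → ℂ)
    (hHα : ∀ z : ℂ, ‖z‖ < R → HasSum (fun N : ℕ => Hα N * z ^ N)
        ((∑' n : ℕ, LiP (homog α n) z) / (1 - z))) (N : ℕ) :
    (Summable fun n : ℕ => ‖HP (homog α n) N‖) ∧ ∑' n : ℕ, HP (homog α n) N = Hα N := by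
  obtain ⟨M, hM, hM0, hb⟩ := dom_bound R α hα (R / 2) (by linarith) (by linarith) hR1
  set r := R / 2 with hr
  have hr0 : 0 < r := by positivity
  have hs : ∀ k, Summable fun n => ‖AA α n k‖ := fun k =>
    Summable.of_nonneg_of_le (fun _ => norm_nonneg _) (fun n => hb n k) (hM.div_const _)
  constructor
  · simp only [← AA_sum]
    exact Summable.of_nonneg_of_le (fun _ => norm_nonneg _) (fun n => norm_sum_le _ _)
      (summable_sum fun k _ => hs k)
  · have e : ∑' n : ℕ, HP (homog α n) N = ∑ k ∈ Finset.range (N + 1), ∑' n, AA α n k := by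
      simp only [← AA_sum]
      exact Summable.tsum_finsetSum fun k _ => (hs k).of_norm
    rw [e]
    refine ps_unique (fun N => ∑ k ∈ Finset.range (N + 1), ∑' n, AA α n k) Hα _ r hr0 ?_
      (fun z hz => hHα z (by linarith)) N
    intro z hz
    have hz1 : ‖z‖ < 1 := by linarith
    have hq : ‖z‖ / r < 1 := (div_lt_one hr0).2 hz
    have hdouble : Summable fun x : ℕ × ℕ => ‖AA α x.1 x.2 * z ^ x.2‖ := by
      have hg : Summable fun k => (‖z‖ / r) ^ k :=
        summable_geometric_of_lt_one (by positivity) hq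
      refine Summable.of_nonneg_of_le (fun _ => norm_nonneg _) (fun x => ?_)
        (hM.mul_of_nonneg hg hM0 (fun k => by positivity))
      rw [norm_mul, norm_pow, div_pow]
      calc _ ≤ M x.1 / r ^ x.2 * ‖z‖ ^ x.2 := by gcongr; exact hb _ _
        _ = _ := by ring
    have hswap : ∑' n, LiP (homog α n) z = ∑' k, (∑' n, AA α n k) * z ^ k := by
      have h1 : ∑' n, LiP (homog α n) z = ∑' n, ∑' k, AA α n k * z ^ k :=
        tsum_congr fun n => (AA_hasSum α n z hz1).tsum_eq.symm
      rw [h1]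
      have := Summable.tsum_comm (f := fun n k => AA α n k * z ^ k) hdouble.of_norm
      rw [← this]
      exact tsum_congr fun k => tsum_mul_right
    have hks : Summable fun k => ‖(∑' n, AA α n k) * z ^ k‖ := by
      have := hdouble.prod_symm.prod
      refine Summable.of_nonneg_of_le (fun _ => norm_nonneg _) (fun k => ?_) this
      rw [← tsum_mul_right]
      exact norm_tsum_le_tsum_norm (hdouble.prod_symm.prod_factor k)
    have hgs : Summable fun k => ‖z ^ k‖ := by
      simpa using summable_geometric_of_lt_one (norm_nonneg z) hz1
    have hc := hasSum_sum_range_mul_of_summable_norm hks hgs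
    rw [tsum_geometric_of_norm_lt_one hz1, ← hswap, ← div_eq_mul_inv] at hc
    convert! hc using 1
    funext m
    rw [Finset.sum_mul]
    refine Finset.sum_congr rfl fun k hk => ?_
    have : k ≤ m := by simpa [Nat.lt_succ_iff] using hk
    rw [mul_assoc, ← pow_add, Nat.add_sub_cancel' this]

/-- Let `α ∈ Dom_{R₁}`, `β ∈ Dom_{R₂}` with Taylor coefficients `Hα`, `Hβ` of
`Li_α(z)/(1−z)`, `Li_β(z)/(1−z)`.  Then for every `N`, the series
`Σ_n H_{(α⧛β)_n}(N)` converges absolutely with sum `Hα(N)·Hβ(N)`. -/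
theorem stuffle_of_domains_pointwise (R₁ R₂ : ℝ) (hR₁0 : 0 < R₁) (hR₁1 : R₁ ≤ 1)
    (hR₂0 : 0 < R₂) (hR₂1 : R₂ ≤ 1) (α β : Comp → ℂ)
    (hα : α ∈ DomR R₁) (hβ : β ∈ DomR R₂) (Hα Hβ : ℕ → ℂ)
    (hHα : ∀ z : ℂ, ‖z‖ < R₁ →
      HasSum (fun N : ℕ => Hα N * z ^ N)
        ((∑' n : ℕ, LiP (homog α n) z) / (1 - z)))
    (hHβ : ∀ z : ℂ, ‖z‖ < R₂ →
      HasSum (fun N : ℕ => Hβ N * z ^ N)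
        ((∑' n : ℕ, LiP (homog β n) z) / (1 - z))) :
    ∀ N : ℕ, (Summable fun n : ℕ => ‖HP (homog (stufA α β) n) N‖) ∧
      ∑' n : ℕ, HP (homog (stufA α β) n) N = Hα N * Hβ N := by

  intro N
  obtain ⟨s1, e1⟩ := dom_main R₁ hR₁0 hR₁1 α hα Hα hHα N
  obtain ⟨s2, e2⟩ := dom_main R₂ hR₂0 hR₂1 β hβ Hβ hHβ N
  have hst : (fun n => HP (homog (stufA α β) n) N) = fun n =>
      ∑ pq ∈ Finset.HasAntidiagonal.antidiagonal n, HP (homog α pq.1) N * HP (homog β pq.2) N :=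
    funext fun n => HP_stufA α β n N
  have s3 := summable_norm_sum_mul_antidiagonal_of_summable_norm s1 s2
  have e3 := tsum_mul_tsum_eq_tsum_sum_antidiagonal_of_summable_norm s1 s2
  rw [← hst, e1, e2] at e3
  refine ⟨?_, e3.symm⟩
  simp only [HP_stufA]
  exact s3
end
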